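/- Fix 0 < q < 1 and define the capacity function C(γ,q) = max_{μ ∈ Λ(γ,q)} I(μ) for γ ≥ 0. Then C(·,q) is strictly concave on [0,∞): for all γ₁ ≠ γ₂ with γ₁, γ₂ > 0 and all θ ∈ (0,1), C(θγ₁ + (1−θ)γ₂, q) > θ C(γ₁,q) + (1−θ) C(γ₂,q). -/

import Mathlib

open MeasureTheory Real Filter

/-- The standard Gaussian density `φ(t) = (2π)^{-1/2} e^{-t²/2}`. -/
noncomputable def gauss (t : ℝ) : ℝ := Real.exp (-t ^ 2 / 2) / Real.sqrt (2 * Real.pi)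

/-- The output density `p_Y(y;μ) = ∫ φ(y−x) dμ(x)`. -/
noncomputable def outDen (μ : Measure ℝ) (y : ℝ) : ℝ := ∫ x, gauss (y - x) ∂μ

/-- The relative entropy `d(x;μ) = ∫ φ(y−x) log(φ(y−x)/p_Y(y;μ)) dy`. -/
noncomputable def relEnt (x : ℝ) (μ : Measure ℝ) : ℝ :=
  ∫ y, gauss (y - x) * Real.log (gauss (y - x) / outDen μ y)

/-- The mutual information `I(μ) = ∫ d(x;μ) dμ(x)`. -/
noncomputable def mutInfo (μ : Measure ℝ) : ℝ := ∫ x, relEnt x μ ∂μ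

/-- The constraint set `Λ(γ,q)`: probability measures with `μ({0}) ≥ q` and second moment
at most `γ`. -/
def memLam (γ q : ℝ) (μ : Measure ℝ) : Prop :=
  IsProbabilityMeasure μ ∧ ENNReal.ofReal q ≤ μ {0} ∧
    ∫⁻ x, ENNReal.ofReal (x ^ 2) ∂μ ≤ ENNReal.ofReal γ

/-- The capacity `C(γ,q) = max_{μ ∈ Λ(γ,q)} I(μ)` (as a supremum). -/
noncomputable def cap (q γ : ℝ) : ℝ := sSup (mutInfo '' {μ : Measure ℝ | memLam γ q μ})


lemma gauss_pos (t : ℝ) : 0 < gauss t := by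
  unfold gauss; positivity

lemma gauss_le_one (t : ℝ) : gauss t ≤ 1 := by
  unfold gauss
  have h1 : Real.exp (-t ^ 2 / 2) ≤ 1 := Real.exp_le_one_iff.mpr (by nlinarith [sq_nonneg t])
  have h2 : 1 ≤ Real.sqrt (2 * Real.pi) := by
    rw [Real.one_le_sqrt]; nlinarith [Real.pi_gt_three]
  rw [div_le_one (by positivity)]
  linarith

lemma gauss_cont : Continuous gauss := by
  unfold gauss; fun_prop

lemma gauss_eq (t : ℝ) : gauss t = ProbabilityTheory.gaussianPDFReal 0 1 t := by
  simp [gauss, ProbabilityTheory.gaussianPDFReal, div_eq_inv_mul]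

lemma gauss_even (t : ℝ) : gauss (-t) = gauss t := by simp [gauss]

lemma gauss_int : Integrable gauss := by
  have := ProbabilityTheory.integrable_gaussianPDFReal 0 1
  exact this.congr (ae_of_all _ fun t => (gauss_eq t).symm)

lemma gauss_integral : ∫ t, gauss t = 1 := by
  simp_rw [gauss_eq]
  exact ProbabilityTheory.integral_gaussianPDFReal_eq_one 0 (by norm_num)

lemma gauss_sq_int : Integrable (fun t => t ^ 2 * gauss t) := by
  have := (integrable_rpow_mul_exp_neg_mul_sq (b := 1/2) (by norm_num) (s := 2) (by norm_num)).div_const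
    (Real.sqrt (2 * Real.pi))
  refine this.congr (ae_of_all _ fun t => ?_)
  simp only [gauss, Real.rpow_two]
  rw [mul_div_assoc]
  congr 3; ring

/-- the Gaussian kernel is integrable on the product. -/
lemma kern_int (μ : Measure ℝ) [IsProbabilityMeasure μ] :
    Integrable (fun z : ℝ × ℝ => gauss (z.2 - z.1)) (μ.prod volume) := by
  rw [integrable_prod_iff (by
    exact (gauss_cont.comp (continuous_snd.sub continuous_fst)).aestronglyMeasurable)]
  constructor
  · exact ae_of_all _ fun x => gauss_int.comp_sub_right x
  · have : ∀ x : ℝ, ∫ y, ‖gauss (y - x)‖ = 1 := by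
      intro x
      simp_rw [Real.norm_of_nonneg (gauss_pos _).le]
      rw [integral_sub_right_eq_self gauss x, gauss_integral]
    simp_rw [this]
    exact integrable_const _

lemma kern_sq_int (μ : Measure ℝ) [IsProbabilityMeasure μ] (h2 : Integrable (fun x : ℝ => x ^ 2) μ) :
    Integrable (fun z : ℝ × ℝ => 2 * z.1 ^ 2 * gauss (z.2 - z.1) +
      2 * ((z.2 - z.1) ^ 2 * gauss (z.2 - z.1))) (μ.prod volume) := by
  have hc : Continuous (fun z : ℝ × ℝ => 2 * z.1 ^ 2 * gauss (z.2 - z.1) +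
      2 * ((z.2 - z.1) ^ 2 * gauss (z.2 - z.1))) := by
    have := gauss_cont
    fun_prop
  rw [integrable_prod_iff hc.aestronglyMeasurable]
  constructor
  · exact ae_of_all _ fun x => ((gauss_int.comp_sub_right x).const_mul (2 * x ^ 2)).add
      ((gauss_sq_int.comp_sub_right x).const_mul 2)
  · have : ∀ x : ℝ, ∫ y, ‖2 * x ^ 2 * gauss (y - x) + 2 * ((y - x) ^ 2 * gauss (y - x))‖
        = 2 * x ^ 2 + 2 * ∫ t, t ^ 2 * gauss t := by
      intro x
      have : ∀ y, ‖2 * x ^ 2 * gauss (y - x) + 2 * ((y - x) ^ 2 * gauss (y - x))‖ =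
        2 * x ^ 2 * gauss (y - x) + 2 * ((y - x) ^ 2 * gauss (y - x)) := fun y =>
          Real.norm_of_nonneg (by have := gauss_pos (y - x); positivity)
      simp_rw [this]
      rw [integral_add ((gauss_int.comp_sub_right x).const_mul _)
        ((gauss_sq_int.comp_sub_right x).const_mul 2), integral_const_mul, integral_const_mul,
        integral_sub_right_eq_self gauss x, gauss_integral,
        integral_sub_right_eq_self (fun t => t ^ 2 * gauss t) x, mul_one]
    simp_rw [this]
    exact (h2.const_mul 2).add (integrable_const _)

lemma kern_sq_integral (μ : Measure ℝ) [IsProbabilityMeasure μ]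
    (h2 : Integrable (fun x : ℝ => x ^ 2) μ) :
    ∫ z : ℝ × ℝ, (2 * z.1 ^ 2 * gauss (z.2 - z.1) +
      2 * ((z.2 - z.1) ^ 2 * gauss (z.2 - z.1))) ∂(μ.prod volume) =
      2 * (∫ x, x ^ 2 ∂μ) + 2 * ∫ t, t ^ 2 * gauss t := by
  rw [integral_prod _ (kern_sq_int μ h2)]
  have : ∀ x : ℝ, ∫ y, (2 * x ^ 2 * gauss (y - x) + 2 * ((y - x) ^ 2 * gauss (y - x)))
        = 2 * x ^ 2 + 2 * ∫ t, t ^ 2 * gauss t := by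
      intro x
      rw [integral_add ((gauss_int.comp_sub_right x).const_mul _)
        ((gauss_sq_int.comp_sub_right x).const_mul 2), integral_const_mul, integral_const_mul,
        integral_sub_right_eq_self gauss x, gauss_integral,
        integral_sub_right_eq_self (fun t => t ^ 2 * gauss t) x, mul_one]
  simp only [this]
  rw [integral_add (h2.const_mul 2) (integrable_const _), integral_const_mul]
  simp

lemma slice_int (μ : Measure ℝ) [IsProbabilityMeasure μ] (y : ℝ) :
    Integrable (fun x => gauss (y - x)) μ := by
  refine Integrable.of_bound (C := 1) ?_ ?_
  · exact (gauss_cont.comp (continuous_const.sub continuous_id)).aestronglyMeasurable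
  · exact ae_of_all _ fun x => by
      rw [Real.norm_of_nonneg (gauss_pos _).le]; exact gauss_le_one _

lemma outDen_pos (μ : Measure ℝ) [IsProbabilityMeasure μ] (y : ℝ) : 0 < outDen μ y := by
  unfold outDen
  rw [integral_pos_iff_support_of_nonneg (fun x => (gauss_pos _).le) (slice_int μ y)]
  have : Function.support (fun x => gauss (y - x)) = Set.univ := by
    ext x; simp [(gauss_pos (y - x)).ne']
  rw [this]; simp

lemma outDen_le_one (μ : Measure ℝ) [IsProbabilityMeasure μ] (y : ℝ) : outDen μ y ≤ 1 := by
  unfold outDen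
  calc _ ≤ ∫ x, (1 : ℝ) ∂μ := integral_mono (slice_int μ y) (integrable_const _) fun x => gauss_le_one _
    _ = 1 := by simp

lemma outDen_meas (μ : Measure ℝ) [IsProbabilityMeasure μ] : Measurable (outDen μ) := by
  have : StronglyMeasurable (fun z : ℝ × ℝ => gauss (z.1 - z.2)) :=
    (gauss_cont.comp (continuous_fst.sub continuous_snd)).stronglyMeasurable
  exact (this.integral_prod_right (ν := μ)).measurable

lemma outDen_int (μ : Measure ℝ) [IsProbabilityMeasure μ] : Integrable (outDen μ) :=
  (kern_int μ).integral_prod_right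

lemma outDen_integral (μ : Measure ℝ) [IsProbabilityMeasure μ] : ∫ y, outDen μ y = 1 := by
  have h := integral_prod_symm _ (kern_int μ)
  have h' := integral_prod _ (kern_int μ)
  unfold outDen
  rw [← h, h']
  simp only
  have : ∀ x : ℝ, ∫ y, gauss (y - x) = 1 := fun x => by
      rw [integral_sub_right_eq_self gauss x, gauss_integral]
  simp [this]

lemma outDen_sq_le (μ : Measure ℝ) [IsProbabilityMeasure μ] (y : ℝ)
   (hi : Integrable (fun x => 2 * x ^ 2 * gauss (y - x) +
      2 * ((y - x) ^ 2 * gauss (y - x))) μ) :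
    y ^ 2 * outDen μ y ≤ ∫ x, (2 * x ^ 2 * gauss (y - x) +
      2 * ((y - x) ^ 2 * gauss (y - x))) ∂μ := by
  unfold outDen
  rw [← integral_const_mul]
  refine integral_mono ((slice_int μ y).const_mul _) hi fun x => ?_
  have := gauss_pos (y - x)
  have h : y ^ 2 ≤ 2 * x ^ 2 + 2 * (y - x) ^ 2 := by nlinarith [sq_nonneg (y - 2 * x)]
  simp only
  nlinarith

lemma outDen_sq_int (μ : Measure ℝ) [IsProbabilityMeasure μ]
    (h2 : Integrable (fun x : ℝ => x ^ 2) μ) : Integrable (fun y => y ^ 2 * outDen μ y) := by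
  have hk := kern_sq_int μ h2
  refine hk.integral_prod_right.mono' ?_ ?_
  · exact ((measurable_id.pow_const 2).mul (outDen_meas μ)).aestronglyMeasurable
  · filter_upwards [hk.prod_left_ae] with y hy
    rw [Real.norm_of_nonneg (by have := outDen_pos μ y; positivity)]
    exact outDen_sq_le μ y hy

lemma outDen_sq_integral (μ : Measure ℝ) [IsProbabilityMeasure μ]
    (h2 : Integrable (fun x : ℝ => x ^ 2) μ) :
    ∫ y, y ^ 2 * outDen μ y ≤ 2 * (∫ x, x ^ 2 ∂μ) + 2 * ∫ t, t ^ 2 * gauss t := by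
  have hk := kern_sq_int μ h2
  rw [← kern_sq_integral μ h2, integral_prod_symm _ hk]
  refine integral_mono_ae (outDen_sq_int μ h2) hk.integral_prod_right ?_
  filter_upwards [hk.prod_left_ae] with y hy
  exact outDen_sq_le μ y hy

lemma pt_bound (p y : ℝ) (hp : 0 < p) (hp1 : p ≤ 1) :
    p * (1 + |Real.log p|) ^ 2 ≤ 8 * (p + y ^ 2 * p + (1 + y ^ 2)⁻¹) := by
  set L := |Real.log p| with hL
  have hL0 : 0 ≤ L := abs_nonneg _
  have hlog : Real.log p = -L := by rw [hL, abs_of_nonpos (Real.log_nonpos hp.le hp1)]; ring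
  set e := Real.exp (-L / 4) with he
  have he0 : 0 < e := Real.exp_pos _
  have hpe : p = e ^ 4 := by
    rw [he, ← Real.exp_nat_mul, ← Real.exp_log hp, hlog]; congr 1; push_cast; ring
  have h1 : e * (1 + L) ≤ 4 := by
    have : (1 + L / 4) ≤ Real.exp (L / 4) := by linarith [Real.add_one_le_exp (L / 4)]
    have h3 : e * Real.exp (L / 4) = 1 := by rw [he, ← Real.exp_add]; simp; ring
    nlinarith
  have h2 : p * (1 + L) ^ 2 ≤ 16 * e ^ 2 := by
    have : (e * (1 + L)) ^ 2 ≤ 16 := by nlinarith [mul_nonneg he0.le (by linarith : 0 ≤ 1 + L)]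
    rw [hpe]; nlinarith [sq_nonneg e]
  have hs : 0 < 1 + y ^ 2 := by positivity
  have h3 : 2 * e ^ 2 ≤ p + y ^ 2 * p + (1 + y ^ 2)⁻¹ := by
    rw [hpe]
    have : e ^ 4 + y ^ 2 * e ^ 4 + (1 + y ^ 2)⁻¹ - 2 * e ^ 2 = (1 + y ^ 2)⁻¹ * ((1 + y ^ 2) * e ^ 2 - 1) ^ 2 := by
      field_simp; ring
    have : 0 ≤ (1 + y ^ 2)⁻¹ * ((1 + y ^ 2) * e ^ 2 - 1) ^ 2 := by positivity
    linarith
  linarith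

/-- dominating function -/
noncomputable def wt (μ : Measure ℝ) (y : ℝ) : ℝ := outDen μ y * (1 + |Real.log (outDen μ y)|) ^ 2

noncomputable def wtConst (γ : ℝ) : ℝ :=
  8 * (1 + (2 * γ + 2 * ∫ t, t ^ 2 * gauss t) + ∫ y : ℝ, (1 + y ^ 2)⁻¹)

lemma wt_meas (μ : Measure ℝ) [IsProbabilityMeasure μ] : Measurable (wt μ) := by
  have := outDen_meas μ
  unfold wt
  have h2 : Measurable fun y => |Real.log (outDen μ y)| := by
    simpa using (this.log).norm
  fun_prop

lemma wt_int (μ : Measure ℝ) [IsProbabilityMeasure μ]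
    (h2 : Integrable (fun x : ℝ => x ^ 2) μ) : Integrable (wt μ) := by
  refine ((((outDen_int μ).add (outDen_sq_int μ h2)).add integrable_inv_one_add_sq).const_mul 8).mono'
    (wt_meas μ).aestronglyMeasurable (ae_of_all _ fun y => ?_)
  have := outDen_pos μ y
  rw [Real.norm_of_nonneg (by unfold wt; positivity)]
  exact pt_bound _ _ (outDen_pos μ y) (outDen_le_one μ y)

lemma wt_integral (μ : Measure ℝ) [IsProbabilityMeasure μ]
    (h2 : Integrable (fun x : ℝ => x ^ 2) μ) (γ : ℝ) (hγ : ∫ x, x ^ 2 ∂μ ≤ γ) :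
    ∫ y, wt μ y ≤ wtConst γ := by
  have hi := ((((outDen_int μ).add (outDen_sq_int μ h2)).add integrable_inv_one_add_sq).const_mul 8)
  refine (integral_mono (wt_int μ h2) hi
    (fun y => pt_bound _ y (outDen_pos μ y) (outDen_le_one μ y))).trans ?_
  have e1 : ∫ y, 8 * (outDen μ y + y ^ 2 * outDen μ y + (1 + y ^ 2)⁻¹) =
    8 * (1 + (∫ y, y ^ 2 * outDen μ y) + ∫ y : ℝ, (1 + y ^ 2)⁻¹) := by
    have e0 : Integrable (fun y => outDen μ y + y ^ 2 * outDen μ y) :=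
      (outDen_int μ).add (outDen_sq_int μ h2)
    rw [integral_const_mul, integral_add e0 integrable_inv_one_add_sq,
      integral_add (outDen_int μ) (outDen_sq_int μ h2), outDen_integral]
  simp only [Pi.add_apply]
  rw [e1]
  unfold wtConst
  have := outDen_sq_integral μ h2
  linarith

noncomputable def ent (μ : Measure ℝ) : ℝ := ∫ y, Real.negMulLog (outDen μ y)

lemma abs_le_wt (p : ℝ) (hp : 0 < p) : p * |Real.log p| ≤ p * (1 + |Real.log p|) ^ 2 := by
  have := abs_nonneg (Real.log p)
  refine mul_le_mul_of_nonneg_left ?_ hp.le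
  nlinarith

lemma plog_int (μ : Measure ℝ) [IsProbabilityMeasure μ]
    (h2 : Integrable (fun x : ℝ => x ^ 2) μ) :
    Integrable (fun y => Real.negMulLog (outDen μ y)) := by
  refine (wt_int μ h2).mono' ?_ (ae_of_all _ fun y => ?_)
  · exact (Real.continuous_negMulLog.measurable.comp (outDen_meas μ)).aestronglyMeasurable
  · have hp := outDen_pos μ y
    rw [Real.negMulLog, norm_mul, norm_neg, Real.norm_of_nonneg hp.le, Real.norm_eq_abs]
    exact abs_le_wt _ hp

lemma ent_le (μ : Measure ℝ) [IsProbabilityMeasure μ]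
    (h2 : Integrable (fun x : ℝ => x ^ 2) μ) (γ : ℝ) (hγ : ∫ x, x ^ 2 ∂μ ≤ γ) :
    ent μ ≤ wtConst γ := by
  refine le_trans ?_ (wt_integral μ h2 γ hγ)
  refine integral_mono (plog_int μ h2) (wt_int μ h2) fun y => ?_
  have hp := outDen_pos μ y
  refine le_trans ?_ (abs_le_wt _ hp)
  simp only [Real.negMulLog]
  rw [neg_mul, ← mul_neg]
  exact mul_le_mul_of_nonneg_left (neg_le_abs _) hp.le

lemma gauss_log_int : Integrable (fun t => gauss t * Real.log (gauss t)) := by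
  have : ∀ t, gauss t * Real.log (gauss t) =
      (-1/2) * (t ^ 2 * gauss t) - Real.log (Real.sqrt (2 * Real.pi)) * gauss t := by
    intro t
    have : Real.log (gauss t) = -t ^ 2 / 2 - Real.log (Real.sqrt (2 * Real.pi)) := by
      unfold gauss
      rw [Real.log_div (Real.exp_pos _).ne' (by positivity), Real.log_exp]
    rw [this]; ring
  simp_rw [this]
  exact (gauss_sq_int.const_mul _).sub (gauss_int.const_mul _)

lemma kern_log_int (μ : Measure ℝ) [IsProbabilityMeasure μ]
    (h2 : Integrable (fun x : ℝ => x ^ 2) μ) :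
    Integrable (fun z : ℝ × ℝ => gauss (z.2 - z.1) * Real.log (outDen μ z.2)) (μ.prod volume) := by
  have hm : Measurable (fun z : ℝ × ℝ => gauss (z.2 - z.1) * Real.log (outDen μ z.2)) := by
    have := gauss_cont.measurable
    have := outDen_meas μ
    fun_prop
  rw [integrable_prod_iff' hm.aestronglyMeasurable]
  constructor
  · exact ae_of_all _ fun y => (slice_int μ y).mul_const (Real.log (outDen μ y))
  · have : ∀ y, ∫ x, ‖gauss (y - x) * Real.log (outDen μ y)‖ ∂μ = ‖Real.negMulLog (outDen μ y)‖ := by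
      intro y
      simp_rw [norm_mul, Real.norm_of_nonneg (gauss_pos _).le]
      rw [integral_mul_const, Real.negMulLog, norm_mul, norm_neg,
        Real.norm_of_nonneg (outDen_pos μ y).le]
      rfl
    simp_rw [this]
    exact (plog_int μ h2).norm

lemma mutInfo_eq (μ : Measure ℝ) [IsProbabilityMeasure μ]
    (h2 : Integrable (fun x : ℝ => x ^ 2) μ) :
    mutInfo μ = (∫ t, gauss t * Real.log (gauss t)) + ent μ := by
  have hk := kern_log_int μ h2
  have h1 : ∀ᵐ x ∂μ, relEnt x μ = (∫ t, gauss t * Real.log (gauss t)) -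
      ∫ y, gauss (y - x) * Real.log (outDen μ y) := by
    filter_upwards [hk.prod_right_ae] with x hx
    unfold relEnt
    rw [← integral_sub_right_eq_self (fun t => gauss t * Real.log (gauss t)) x,
      ← integral_sub (gauss_log_int.comp_sub_right x) hx]
    congr 1; ext y
    rw [Real.log_div (gauss_pos _).ne' (outDen_pos μ y).ne']; ring
  unfold mutInfo
  rw [integral_congr_ae h1, integral_sub (integrable_const _) hk.integral_prod_left]
  have h3 : ∫ x, (∫ y, gauss (y - x) * Real.log (outDen μ y)) ∂μ = - ent μ := by
    have a := integral_prod _ hk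
    have b := integral_prod_symm _ hk
    simp only at a b
    rw [← a, b]
    unfold ent
    rw [← integral_neg]
    congr 1; ext y
    rw [integral_mul_const, Real.negMulLog]
    simp only [neg_mul, neg_neg]; rfl
  simp only
  rw [h3]; simp

lemma hell (a p : ℝ) (ha : 0 < a) (hp : 0 < p) :
    0 ≤ a * Real.log a - a * Real.log p - a + p ∧
    (a - p) ^ 2 ≤ 2 * (a + p) * (a * Real.log a - a * Real.log p - a + p) := by
  obtain ⟨r, hr, rfl⟩ : ∃ r : ℝ, 0 < r ∧ r ^ 2 = a := ⟨√a, Real.sqrt_pos.2 ha, Real.sq_sqrt ha.le⟩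
  obtain ⟨s, hs, rfl⟩ : ∃ r : ℝ, 0 < r ∧ r ^ 2 = p := ⟨√p, Real.sqrt_pos.2 hp, Real.sq_sqrt hp.le⟩
  have h := Real.one_sub_inv_le_log_of_pos (div_pos hr hs)
  rw [Real.log_div hr.ne' hs.ne', inv_div] at h
  have h1 : r ^ 2 * (1 - s / r) ≤ r ^ 2 * (Real.log r - Real.log s) :=
    mul_le_mul_of_nonneg_left h (by positivity)
  have h2 : r ^ 2 * (1 - s / r) = r ^ 2 - r * s := by field_simp
  rw [Real.log_pow, Real.log_pow]
  push_cast
  have h3 : (r - s) ^ 2 ≤ r ^ 2 * (2 * Real.log r) - r ^ 2 * (2 * Real.log s) - r ^ 2 + s ^ 2 := by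
    nlinarith
  refine ⟨(sq_nonneg _).trans h3, ?_⟩
  calc (r ^ 2 - s ^ 2) ^ 2 = (r + s) ^ 2 * (r - s) ^ 2 := by ring
    _ ≤ 2 * (r ^ 2 + s ^ 2) * (r - s) ^ 2 :=
        mul_le_mul_of_nonneg_right (by nlinarith [sq_nonneg (r - s)]) (sq_nonneg _)
    _ ≤ _ := mul_le_mul_of_nonneg_left h3 (by positivity)

noncomputable def cA (θ : ℝ) : ℝ := 2 * (1 / θ + 1) / (θ * (1 - θ) ^ 2)
noncomputable def cB (θ : ℝ) : ℝ := 1 / θ + 1 / (1 - θ)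

lemma pt_gap (θ a b : ℝ) (h0 : 0 < θ) (h1 : θ < 1) (ha : 0 < a) (hb : 0 < b) :
    0 ≤ Real.negMulLog (θ * a + (1 - θ) * b) -
      (θ * Real.negMulLog a + (1 - θ) * Real.negMulLog b) ∧
    ∀ t : ℝ, 0 < t → |Real.negMulLog a - Real.negMulLog b| ≤
      (cA θ / t + cB θ) * (Real.negMulLog (θ * a + (1 - θ) * b) -
      (θ * Real.negMulLog a + (1 - θ) * Real.negMulLog b)) +
      t * ((θ * a + (1 - θ) * b) * (1 + |Real.log (θ * a + (1 - θ) * b)|) ^ 2) := by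
  have h1' : 0 < 1 - θ := by linarith
  set p := θ * a + (1 - θ) * b with hpdef
  have hp : 0 < p := by positivity
  obtain ⟨hDa, hDa2⟩ := hell a p ha hp
  obtain ⟨hDb, hDb2⟩ := hell b p hb hp
  set Da := a * Real.log a - a * Real.log p - a + p with hDadef
  set Db := b * Real.log b - b * Real.log p - b + p with hDbdef
  set g := Real.negMulLog p - (θ * Real.negMulLog a + (1 - θ) * Real.negMulLog b) with hgdef
  have hg : g = θ * Da + (1 - θ) * Db := by
    rw [hgdef, hDadef, hDbdef]
    simp only [Real.negMulLog]
    have : p * Real.log p = (θ * a + (1 - θ) * b) * Real.log p := by rw [← hpdef]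
    have e : θ * p + (1 - θ) * p = θ * a + (1 - θ) * b := by rw [← hpdef]; ring
    linear_combination e - this
  have hA : θ * Da ≤ g := by rw [hg]; nlinarith [mul_nonneg h1'.le hDb]
  have hB : (1 - θ) * Db ≤ g := by rw [hg]; nlinarith [mul_nonneg h0.le hDa]
  have hg0 : 0 ≤ g := (mul_nonneg h0.le hDa).trans hA
  refine ⟨hg0, fun t ht => ?_⟩
  have hA' : Da ≤ 1 / θ * g := by
    rw [div_mul_eq_mul_div, one_mul, le_div_iff₀ h0]; linarith
  have hB' : Db ≤ 1 / (1 - θ) * g := by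
    rw [div_mul_eq_mul_div, one_mul, le_div_iff₀ h1']; linarith
  have hap : a ≤ 1 / θ * p := by
    rw [div_mul_eq_mul_div, one_mul, le_div_iff₀ h0, hpdef]; nlinarith [mul_pos h1' hb]
  have hsq : (a - b) ^ 2 ≤ cA θ * (p * g) := by
    have e1 : (a - p) ^ 2 = (1 - θ) ^ 2 * (a - b) ^ 2 := by rw [hpdef]; ring
    have e2 : 2 * (a + p) * Da ≤ 2 * ((1 / θ + 1) * p) * (1 / θ * g) := by
      apply mul_le_mul _ hA' hDa (by positivity)
      have : (1 / θ + 1) * p = 1 / θ * p + p := by ring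
      rw [this]; linarith
    have e3 : (1 - θ) ^ 2 * (a - b) ^ 2 ≤ 2 * ((1 / θ + 1) * p) * (1 / θ * g) := by
      rw [← e1]; exact hDa2.trans e2
    have e4 : cA θ * (p * g) = (2 * ((1 / θ + 1) * p) * (1 / θ * g)) / (1 - θ) ^ 2 := by
      unfold cA; field_simp
    rw [e4, le_div_iff₀ (by positivity)]
    linarith
  set M := 1 + |Real.log p| with hM
  have hM0 : 0 < M := by positivity
  have hx : |a - b| * M ≤ cA θ / t * g + t * (p * M ^ 2) := by
    have hx0 := abs_nonneg (a - b)
    rw [← sq_abs] at hsq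
    set x := |a - b|
    have : x * M * (t * p) ≤ (cA θ / t * g + t * (p * M ^ 2)) * (t * p) := by
      have e : (cA θ / t * g + t * (p * M ^ 2)) * (t * p) = cA θ * (p * g) + (t * p * M) ^ 2 := by
        field_simp
      rw [e]
      have n1 := sq_nonneg (x - t * p * M)
      have n2 := mul_nonneg hx0 (by positivity : 0 ≤ t * p * M)
      have n3 : (x - t * p * M) ^ 2 = x ^ 2 - 2 * (x * (t * p * M)) + (t * p * M) ^ 2 := by ring
      have n4 : x * M * (t * p) = x * (t * p * M) := by ring
      rw [n4]; linarith
    exact le_of_mul_le_mul_right this (by positivity)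
  have hid : Real.negMulLog a - Real.negMulLog b = (b - a) * (Real.log p + 1) + Db - Da := by
    simp only [Real.negMulLog, hDadef, hDbdef]; ring
  have hl : |Real.log p + 1| ≤ M := by
    refine (abs_add_le _ _).trans ?_
    simp [hM, add_comm]
  have hz : |(b - a) * (Real.log p + 1)| ≤ |a - b| * M := by
    rw [abs_mul, abs_sub_comm]
    exact mul_le_mul_of_nonneg_left hl (abs_nonneg _)
  have hfin : cB θ * g = 1 / θ * g + 1 / (1 - θ) * g := by unfold cB; ring
  rw [hid, add_mul, hfin]
  obtain ⟨hz1, hz2⟩ := abs_le.1 hz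
  have n1 : 0 ≤ 1 / θ * g := by positivity
  have n2 : 0 ≤ 1 / (1 - θ) * g := by positivity
  rw [abs_le]; constructor <;> linarith

noncomputable def mix (θ : ℝ) (μ ν : Measure ℝ) : Measure ℝ :=
  ENNReal.ofReal θ • μ + ENNReal.ofReal (1 - θ) • ν

lemma mix_prob (θ : ℝ) (h0 : 0 < θ) (h1 : θ < 1) (μ ν : Measure ℝ) [IsProbabilityMeasure μ]
    [IsProbabilityMeasure ν] : IsProbabilityMeasure (mix θ μ ν) := by
  constructor
  simp only [mix, Measure.add_apply, Measure.smul_apply, measure_univ, smul_eq_mul, mul_one]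
  rw [← ENNReal.ofReal_add h0.le (by linarith)]
  simp

lemma mix_integrable (θ : ℝ) (μ ν : Measure ℝ) (f : ℝ → ℝ) (hf : Integrable f μ)
    (hf' : Integrable f ν) : Integrable f (mix θ μ ν) :=
  (hf.smul_measure ENNReal.ofReal_ne_top).add_measure (hf'.smul_measure ENNReal.ofReal_ne_top)

lemma mix_integral (θ : ℝ) (h0 : 0 < θ) (h1 : θ < 1) (μ ν : Measure ℝ) (f : ℝ → ℝ)
    (hf : Integrable f μ) (hf' : Integrable f ν) :
    ∫ x, f x ∂(mix θ μ ν) = θ * (∫ x, f x ∂μ) + (1 - θ) * ∫ x, f x ∂ν := by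
  unfold mix
  rw [integral_add_measure (hf.smul_measure ENNReal.ofReal_ne_top)
    (hf'.smul_measure ENNReal.ofReal_ne_top), integral_smul_measure, integral_smul_measure,
    ENNReal.toReal_ofReal h0.le, ENNReal.toReal_ofReal (by linarith)]
  simp

lemma mix_outDen (θ : ℝ) (h0 : 0 < θ) (h1 : θ < 1) (μ ν : Measure ℝ) [IsProbabilityMeasure μ]
    [IsProbabilityMeasure ν] (y : ℝ) :
    outDen (mix θ μ ν) y = θ * outDen μ y + (1 - θ) * outDen ν y :=
  mix_integral θ h0 h1 μ ν _ (slice_int μ y) (slice_int ν y)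

lemma ent_gap (θ : ℝ) (h0 : 0 < θ) (h1 : θ < 1) (μ ν : Measure ℝ) [IsProbabilityMeasure μ]
    [IsProbabilityMeasure ν] (hμ : Integrable (fun x : ℝ => x ^ 2) μ)
    (hν : Integrable (fun x : ℝ => x ^ 2) ν) :
    0 ≤ ent (mix θ μ ν) - (θ * ent μ + (1 - θ) * ent ν) ∧
    ∀ γ t : ℝ, 0 < t → ∫ x, x ^ 2 ∂(mix θ μ ν) ≤ γ → |ent μ - ent ν| ≤
      (cA θ / t + cB θ) * (ent (mix θ μ ν) - (θ * ent μ + (1 - θ) * ent ν)) + t * wtConst γ := by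
  have hP := mix_prob θ h0 h1 μ ν
  have hm := mix_integrable θ μ ν _ hμ hν
  have iμ := plog_int μ hμ
  have iν := plog_int ν hν
  have im := plog_int _ hm
  have ig : Integrable (fun y => Real.negMulLog (outDen (mix θ μ ν) y) -
      (θ * Real.negMulLog (outDen μ y) + (1 - θ) * Real.negMulLog (outDen ν y))) :=
    im.sub ((iμ.const_mul θ).add (iν.const_mul (1 - θ)))
  have eg : ent (mix θ μ ν) - (θ * ent μ + (1 - θ) * ent ν) =
    ∫ y, (Real.negMulLog (outDen (mix θ μ ν) y) -
      (θ * Real.negMulLog (outDen μ y) + (1 - θ) * Real.negMulLog (outDen ν y))) := by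
    have ia : Integrable (fun y => θ * Real.negMulLog (outDen μ y) +
        (1 - θ) * Real.negMulLog (outDen ν y)) :=
      (iμ.const_mul θ).add (iν.const_mul (1 - θ))
    rw [integral_sub im ia,
      integral_add (iμ.const_mul θ) (iν.const_mul (1 - θ)), integral_const_mul, integral_const_mul]
    rfl
  have hpt := fun y => pt_gap θ _ _ h0 h1 (outDen_pos μ y) (outDen_pos ν y)
  simp only [← mix_outDen θ h0 h1 μ ν] at hpt
  rw [eg]
  refine ⟨integral_nonneg fun y => (hpt y).1, fun γ t ht hγ => ?_⟩
  have iw := wt_int _ hm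
  calc |ent μ - ent ν| = |∫ y, (Real.negMulLog (outDen μ y) - Real.negMulLog (outDen ν y))| := by
        rw [integral_sub iμ iν]; rfl
    _ ≤ ∫ y, |Real.negMulLog (outDen μ y) - Real.negMulLog (outDen ν y)| :=
        abs_integral_le_integral_abs
    _ ≤ ∫ y, ((cA θ / t + cB θ) * (Real.negMulLog (outDen (mix θ μ ν) y) -
      (θ * Real.negMulLog (outDen μ y) + (1 - θ) * Real.negMulLog (outDen ν y))) +
        t * wt (mix θ μ ν) y) :=
        integral_mono (iμ.sub iν).abs ((ig.const_mul _).add (iw.const_mul t))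
          fun y => (hpt y).2 t ht
    _ ≤ _ := by
        rw [integral_add (ig.const_mul _) (iw.const_mul t), integral_const_mul, integral_const_mul]
        have := mul_le_mul_of_nonneg_left (wt_integral _ hm γ hγ) ht.le
        linarith

lemma memLam_int {γ q : ℝ} (hγ : 0 ≤ γ) {μ : Measure ℝ} (h : memLam γ q μ) :
    Integrable (fun x : ℝ => x ^ 2) μ ∧ ∫ x, x ^ 2 ∂μ ≤ γ := by
  obtain ⟨_, _, h⟩ := h
  have hm : AEStronglyMeasurable (fun x : ℝ => x ^ 2) μ := by fun_prop
  refine ⟨⟨hm, ?_⟩, ?_⟩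
  · rw [hasFiniteIntegral_iff_ofReal (ae_of_all _ fun x => sq_nonneg x)]
    exact h.trans_lt ENNReal.ofReal_lt_top
  · rw [integral_eq_lintegral_of_nonneg_ae (ae_of_all _ fun x => sq_nonneg x) hm]
    exact ENNReal.toReal_le_of_le_ofReal hγ h

lemma memLam_mix {γ₁ γ₂ q θ : ℝ} (h0 : 0 < θ) (h1 : θ < 1) (hq : 0 < q) (hγ₁ : 0 < γ₁)
    (hγ₂ : 0 < γ₂) {μ ν : Measure ℝ} (hμ : memLam γ₁ q μ) (hν : memLam γ₂ q ν) :
    memLam (θ * γ₁ + (1 - θ) * γ₂) q (mix θ μ ν) := by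
  obtain ⟨p1, a1, b1⟩ := hμ
  obtain ⟨p2, a2, b2⟩ := hν
  have h1' : 0 ≤ 1 - θ := by linarith
  refine ⟨mix_prob θ h0 h1 μ ν, ?_, ?_⟩
  · simp only [mix, Measure.add_apply, Measure.smul_apply, smul_eq_mul]
    calc ENNReal.ofReal q = ENNReal.ofReal θ * ENNReal.ofReal q + ENNReal.ofReal (1 - θ) * ENNReal.ofReal q := by
          rw [← add_mul, ← ENNReal.ofReal_add h0.le h1']; simp
      _ ≤ _ := by gcongr
  · simp only [mix, lintegral_add_measure, lintegral_smul_measure, smul_eq_mul]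
    rw [ENNReal.ofReal_add (by positivity) (by positivity), ENNReal.ofReal_mul h0.le,
      ENNReal.ofReal_mul h1']
    gcongr

lemma memLam_dirac {γ q : ℝ} (hq1 : q < 1) : memLam γ q (Measure.dirac 0) := by
  refine ⟨inferInstance, ?_, ?_⟩
  · simp [hq1.le]
  · rw [lintegral_dirac' _ (by fun_prop)]; simp

lemma memLam_mono {γ γ' q : ℝ} (h : γ ≤ γ') {μ : Measure ℝ} (hμ : memLam γ q μ) : memLam γ' q μ :=
  ⟨hμ.1, hμ.2.1, hμ.2.2.trans (ENNReal.ofReal_le_ofReal h)⟩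

lemma bdd {γ q : ℝ} (hγ : 0 ≤ γ) : BddAbove (mutInfo '' {μ : Measure ℝ | memLam γ q μ}) := by
  refine ⟨(∫ t, gauss t * Real.log (gauss t)) + wtConst γ, ?_⟩
  rintro _ ⟨μ, hμ, rfl⟩
  have := hμ.1
  obtain ⟨i, j⟩ := memLam_int hγ hμ
  rw [mutInfo_eq μ i]
  have := ent_le μ i γ j
  linarith

lemma le_cap {γ q : ℝ} (hγ : 0 ≤ γ) {μ : Measure ℝ} (h : memLam γ q μ) : mutInfo μ ≤ cap q γ :=
  le_csSup (bdd hγ) ⟨μ, h, rfl⟩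

lemma exists_near {γ q : ℝ} (hq1 : q < 1) (ε : ℝ) (hε : 0 < ε) :
    ∃ μ, memLam γ q μ ∧ cap q γ - ε < mutInfo μ := by
  have hne : (mutInfo '' {μ : Measure ℝ | memLam γ q μ}).Nonempty :=
    ⟨_, Measure.dirac 0, memLam_dirac hq1, rfl⟩
  obtain ⟨_, ⟨μ, hμ, rfl⟩, h⟩ := exists_lt_of_lt_csSup hne (by
    show cap q γ - ε < cap q γ; linarith)
  exact ⟨μ, hμ, h⟩

lemma mutInfo_mix_ge {θ : ℝ} (h0 : 0 < θ) (h1 : θ < 1) (μ ν : Measure ℝ) [IsProbabilityMeasure μ]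
    [IsProbabilityMeasure ν] (hμ : Integrable (fun x : ℝ => x ^ 2) μ)
    (hν : Integrable (fun x : ℝ => x ^ 2) ν) :
    θ * mutInfo μ + (1 - θ) * mutInfo ν ≤ mutInfo (mix θ μ ν) := by
  have := mix_prob θ h0 h1 μ ν
  rw [mutInfo_eq μ hμ, mutInfo_eq ν hν, mutInfo_eq _ (mix_integrable θ μ ν _ hμ hν)]
  have := (ent_gap θ h0 h1 μ ν hμ hν).1
  linarith

lemma cap_concave {γ₁ γ₂ q θ : ℝ} (h0 : 0 < θ) (h1 : θ < 1) (hq : 0 < q) (hq1 : q < 1) (hγ₁ : 0 < γ₁)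
    (hγ₂ : 0 < γ₂) : θ * cap q γ₁ + (1 - θ) * cap q γ₂ ≤ cap q (θ * γ₁ + (1 - θ) * γ₂) := by
  refine le_of_forall_pos_le_add fun ε hε => ?_
  have h1' : 0 < 1 - θ := by linarith
  obtain ⟨μ, hμ, hμ'⟩ := exists_near (γ := γ₁) hq1 ε hε
  obtain ⟨ν, hν, hν'⟩ := exists_near (γ := γ₂) hq1 ε hε
  have := hμ.1
  have := hν.1
  have a := mutInfo_mix_ge h0 h1 μ ν (memLam_int hγ₁.le hμ).1 (memLam_int hγ₂.le hν).1
  have b := le_cap (by positivity) (memLam_mix h0 h1 hq hγ₁ hγ₂ hμ hν)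
  nlinarith

lemma cap_unbounded {q : ℝ} (hq : 0 < q) (hq1 : q < 1) (B : ℝ) :
    ∃ γ μ, memLam γ q μ ∧ B < mutInfo μ := by
  set G := ∫ t, gauss t * Real.log (gauss t) with hG
  set D := mutInfo (Measure.dirac 0) with hD
  have hq' : 0 < 1 - q := by linarith
  obtain ⟨R, hR⟩ : ∃ R, B < q * D + (1 - q) * (G + R) := by
    refine ⟨(B - q * D + 1) / (1 - q) - G, ?_⟩
    have : (1 - q) * (G + ((B - q * D + 1) / (1 - q) - G)) = B - q * D + 1 := by
      field_simp; ring
    rw [this]; linarith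
  set V := Real.exp R with hV
  have hV0 : 0 < V := Real.exp_pos _
  set U : Measure ℝ := ENNReal.ofReal V⁻¹ • (volume.restrict (Set.Icc 0 V)) with hU
  have hUp : IsProbabilityMeasure U := by
    constructor
    simp only [hU, Measure.smul_apply, Measure.restrict_apply_univ, Real.volume_Icc, smul_eq_mul,
      sub_zero]
    rw [← ENNReal.ofReal_mul (by positivity), inv_mul_cancel₀ hV0.ne']; simp
  have hUac : ∀ᵐ x ∂U, x ∈ Set.Icc 0 V := by
    rw [hU]
    exact Measure.ae_smul_measure (ae_restrict_mem measurableSet_Icc) _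
  have hU2 : Integrable (fun x : ℝ => x ^ 2) U := by
    refine Integrable.of_bound (C := V ^ 2) (by fun_prop) ?_
    filter_upwards [hUac] with x hx
    rw [Real.norm_of_nonneg (sq_nonneg _)]
    exact pow_le_pow_left₀ hx.1 hx.2 2
  have hout : ∀ y, outDen U y ≤ V⁻¹ := by
    intro y
    unfold outDen
    rw [hU, integral_smul_measure, ENNReal.toReal_ofReal (by positivity), smul_eq_mul]
    have hi : Integrable (fun x => gauss (y - x)) := gauss_int.comp_sub_left y
    have : ∫ x in Set.Icc 0 V, gauss (y - x) ≤ 1 := by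
      calc _ ≤ ∫ x, gauss (y - x) := setIntegral_le_integral hi (ae_of_all _ fun x => (gauss_pos _).le)
        _ = 1 := by rw [integral_sub_left_eq_self gauss volume y, gauss_integral]
    nlinarith [inv_pos.2 hV0]
  have hent : R ≤ ent U := by
    calc R = ∫ y, R * outDen U y := by rw [integral_const_mul, outDen_integral, mul_one]
      _ ≤ ent U := by
        refine integral_mono ((outDen_int U).const_mul R) (plog_int U hU2) fun y => ?_
        have hp := outDen_pos U y
        have : Real.log (outDen U y) ≤ -R := by
          have := Real.log_le_log hp (hout y)
          rwa [Real.log_inv, hV, Real.log_exp] at this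
        simp only [Real.negMulLog]
        nlinarith
  have hd : memLam 1 q (Measure.dirac 0) := memLam_dirac hq1
  have hd2 := (memLam_int zero_le_one hd).1
  have hmp := mix_prob q hq hq1 (Measure.dirac 0) U
  refine ⟨∫ x, x ^ 2 ∂(mix q (Measure.dirac 0) U), mix q (Measure.dirac 0) U, ⟨hmp, ?_, ?_⟩, ?_⟩
  · simp [mix]
  · rw [ofReal_integral_eq_lintegral_ofReal (mix_integrable q _ _ _ hd2 hU2)
      (ae_of_all _ fun x => sq_nonneg x)]
  · have := mutInfo_mix_ge hq hq1 (Measure.dirac 0) U hd2 hU2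
    rw [mutInfo_eq U hU2, ← hG, ← hD] at this
    nlinarith

lemma cap_lt {γ₁ γ₂ q : ℝ} (hq : 0 < q) (hq1 : q < 1) (h1 : 0 < γ₁) (h12 : γ₁ < γ₂) :
    cap q γ₁ < cap q γ₂ := by
  obtain ⟨γ, μ, hμ, hB⟩ := cap_unbounded hq hq1 (cap q γ₂)
  set γ₃ := max γ (γ₂ + 1) with h3
  have h23 : γ₂ < γ₃ := lt_of_lt_of_le (by linarith) (le_max_right _ _)
  have hc : cap q γ₂ < cap q γ₃ :=
    hB.trans_le (le_cap (by linarith) (memLam_mono (le_max_left _ _) hμ))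
  set θ := (γ₃ - γ₂) / (γ₃ - γ₁) with hθ
  have hd : 0 < γ₃ - γ₁ := by linarith
  have t0 : 0 < θ := div_pos (by linarith) hd
  have t1 : θ < 1 := by rw [hθ, div_lt_one hd]; linarith
  have he : θ * γ₁ + (1 - θ) * γ₃ = γ₂ := by
    rw [hθ]; field_simp; ring
  have := cap_concave t0 t1 hq hq1 h1 (by linarith : 0 < γ₃)
  rw [he] at this
  by_contra! hcon
  nlinarith

/-- for fixed `0 < q < 1`, the capacity `C(·,q)` is strictly concave on `[0,∞)`:
for all `γ₁ ≠ γ₂` with `γ₁, γ₂ > 0` and `θ ∈ (0,1)`,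
`C(θγ₁ + (1−θ)γ₂, q) > θ C(γ₁,q) + (1−θ) C(γ₂,q)`. -/
theorem cap_strictConcave (q : ℝ) (hq0 : 0 < q) (hq1 : q < 1) :
    ∀ γ₁ γ₂ θ : ℝ, 0 < γ₁ → 0 < γ₂ → γ₁ ≠ γ₂ → θ ∈ Set.Ioo (0 : ℝ) 1 →
      θ * cap q γ₁ + (1 - θ) * cap q γ₂ < cap q (θ * γ₁ + (1 - θ) * γ₂) := by
  intro γ₁ γ₂ θ hγ₁ hγ₂ hne ⟨h0, h1⟩
  have h1' : 0 < 1 - θ := by linarith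
  by_contra! hcon
  have hΔ : 0 < |cap q γ₁ - cap q γ₂| := by
    rw [abs_pos, sub_ne_zero]
    rcases lt_or_gt_of_ne hne with h | h
    · exact (cap_lt hq0 hq1 hγ₁ h).ne
    · exact (cap_lt hq0 hq1 hγ₂ h).ne'
  set Δ := |cap q γ₁ - cap q γ₂|
  set γ := θ * γ₁ + (1 - θ) * γ₂ with hγ
  have hγ0 : 0 < γ := by positivity
  obtain ⟨t, ht, htΔ⟩ : ∃ t, 0 < t ∧ t * wtConst γ ≤ Δ / 4 := by
    refine ⟨Δ / 4 / (|wtConst γ| + 1), by positivity, ?_⟩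
    rw [div_mul_eq_mul_div, div_le_iff₀ (by positivity)]
    exact mul_le_mul_of_nonneg_left (by linarith [le_abs_self (wtConst γ)]) (by positivity)
  have hK : 0 < cA θ / t + cB θ := by unfold cA cB; positivity
  set K := cA θ / t + cB θ
  obtain ⟨ε, hε, hεK, hεΔ⟩ : ∃ ε, 0 < ε ∧ K * ε ≤ Δ / 4 ∧ ε ≤ Δ / 8 := by
    refine ⟨min (Δ / 4 / K) (Δ / 8), by positivity, ?_, min_le_right _ _⟩
    calc K * min (Δ / 4 / K) (Δ / 8) ≤ K * (Δ / 4 / K) :=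
          mul_le_mul_of_nonneg_left (min_le_left _ _) hK.le
      _ = Δ / 4 := by field_simp
  obtain ⟨μ, hμ, hμ'⟩ := exists_near (γ := γ₁) hq1 ε hε
  obtain ⟨ν, hν, hν'⟩ := exists_near (γ := γ₂) hq1 ε hε
  have := hμ.1
  have := hν.1
  have i1 := (memLam_int hγ₁.le hμ).1
  have i2 := (memLam_int hγ₂.le hν).1
  have hm := memLam_mix h0 h1 hq0 hγ₁ hγ₂ hμ hν
  have := hm.1
  obtain ⟨i3, j3⟩ := memLam_int hγ0.le hm
  have hgap := (ent_gap θ h0 h1 μ ν i1 i2).2 γ t ht j3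
  have c1 := le_cap hγ₁.le hμ
  have c2 := le_cap hγ₂.le hν
  have c3 := le_cap hγ0.le hm
  have e1 := mutInfo_eq μ i1
  have e2 := mutInfo_eq ν i2
  have e3 := mutInfo_eq _ i3
  have hg : ent (mix θ μ ν) - (θ * ent μ + (1 - θ) * ent ν) ≤ ε := by
    have : ent (mix θ μ ν) - (θ * ent μ + (1 - θ) * ent ν) =
      mutInfo (mix θ μ ν) - (θ * mutInfo μ + (1 - θ) * mutInfo ν) := by
      rw [e1, e2, e3]; ring
    rw [this]
    nlinarith
  have hg' := mul_le_mul_of_nonneg_left hg hK.le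
  have hd : |ent μ - ent ν| ≤ Δ / 2 := by linarith
  have hsub : ent μ - ent ν = mutInfo μ - mutInfo ν := by rw [e1, e2]; ring
  rw [hsub] at hd
  obtain ⟨d1, d2⟩ := abs_le.1 hd
  have : Δ ≤ Δ / 2 + Δ / 8 := by
    apply abs_le.2
    constructor <;> linarith
  linarith
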